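/- Fix η ∈ {i, j, k} and let A₁, C₁, A₂, A₃, B₁, D₁ and D₃ be quaternion matrices of conformable sizes with D₃ = D₃^{η*}. Define B₄ := A₂L_{A₁}, C₄ := A₃(R_{B₁})^{η*}, D₄ := D₃ − A₂[A₁†C₁ + (A₁†C₁)^{η*} − A₁†A₁C₁^{η*}(A₁†)^{η*}]A₂^{η*} − A₃[D₁B₁† + (D₁B₁†)^{η*} − (B₁†)^{η*}B₁^{η*}D₁B₁†]A₃^{η*}, M := R_{B₄}C₄ and S := C₄L_M. Then the system A₁X = C₁, YB₁ = D₁, A₂XA₂^{η*} + A₃YA₃^{η*} = D₃ has a solution (X, Y) with X = X^{η*} and Y = Y^{η*} if and only if A₁C₁^{η*} = C₁A₁^{η*}, B₁^{η*}D₁ = D₁^{η*}B₁, R_{A₁}C₁ = 0, D₁L_{B₁} = 0, R_M R_{B₄}D₄ = 0 and R_{B₄}D₄(R_{C₄})^{η*} = 0. -/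

import Mathlib

open scoped Quaternion Classical
open Matrix

noncomputable section

/-- The four Moore–Penrose conditions for `X` to be the Moore–Penrose inverse of `A`
over the real quaternions. -/
def IsMP {m n : Type*} [Fintype m] [Fintype n]
    (A : Matrix m n ℍ[ℝ]) (X : Matrix n m ℍ[ℝ]) : Prop :=
  A * X * A = A ∧ X * A * X = X ∧ (A * X)ᴴ = A * X ∧ (X * A)ᴴ = X * A

/-- The Moore–Penrose inverse `A†` of a quaternion matrix (it exists and is unique). -/
def dg {m n : Type*} [Fintype m] [Fintype n]
    (A : Matrix m n ℍ[ℝ]) : Matrix n m ℍ[ℝ] :=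
  if h : ∃ X, IsMP A X then h.choose else 0

/-- `L_A = I - A† A`. -/
def lproj {m n : Type*} [Fintype m] [Fintype n] [DecidableEq n]
    (A : Matrix m n ℍ[ℝ]) : Matrix n n ℍ[ℝ] :=
  1 - dg A * A

/-- `R_A = I - A A†`. -/
def rproj {m n : Type*} [Fintype m] [Fintype n] [DecidableEq m]
    (A : Matrix m n ℍ[ℝ]) : Matrix m m ℍ[ℝ] :=
  1 - A * dg A

/-- `A^{η*} = -η A* η`, entrywise. -/
def etaC (η : ℍ[ℝ]) {m n : Type*} (A : Matrix m n ℍ[ℝ]) : Matrix n m ℍ[ℝ] :=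
  Matrix.of fun i j => -η * star (A j i) * η

/-- `η` is one of the quaternion units `i`, `j`, `k`. -/
def IsImUnit (η : ℍ[ℝ]) : Prop :=
  η = ⟨0, 1, 0, 0⟩ ∨ η = ⟨0, 0, 1, 0⟩ ∨ η = ⟨0, 0, 0, 1⟩

section GeneralizedInverse

variable {m n : Type*} [Fintype m]

theorem Matrix.eq_zero_of_conjTranspose_mul_self_eq_zero {A : Matrix m n ℍ[ℝ]}
    (h : Aᴴ * A = 0) : A = 0 := by
  ext1 i j
  have hj : ∑ k, Quaternion.normSq (A k j) = 0 := by
    have h' := congrFun (congrFun h j) j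
    simp only [mul_apply, conjTranspose_apply, Quaternion.star_mul_self, zero_apply] at h'
    exact Quaternion.coe_injective ((map_sum (algebraMap ℝ ℍ[ℝ]) _ _).trans h')
  exact Quaternion.normSq_eq_zero.mp
    ((Finset.sum_eq_zero_iff_of_nonneg fun k _ => Quaternion.normSq_nonneg).mp hj i
      (Finset.mem_univ i))

variable [Fintype n]

theorem Matrix.exists_mul_mul_self_eq (A : Matrix m n ℍ[ℝ]) :
    ∃ G : Matrix n m ℍ[ℝ], A * G * A = A := by
  let f := toLinearMapRight' A
  obtain ⟨g, hg⟩ := f.rangeRestrict.exists_rightInverse_of_surjective f.range_rangeRestrict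
  obtain ⟨r, hr⟩ := f.range.subtype.exists_leftInverse_of_injective f.range.ker_subtype
  refine ⟨toLinearMapRight'.symm (g ∘ₗ r), toLinearMapRight'.injective ?_⟩
  rw [toLinearMapRight'_mul, toLinearMapRight'_mul, LinearEquiv.apply_symm_apply]
  refine LinearMap.ext fun x => ?_
  have h₁ : r (f.range.subtype (f.rangeRestrict x)) = f.rangeRestrict x :=
    LinearMap.congr_fun hr _
  have h₂ : f.rangeRestrict (g (f.rangeRestrict x)) = f.rangeRestrict x :=
    LinearMap.congr_fun hg _
  change f (g (r (f.range.subtype (f.rangeRestrict x)))) = f x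
  rw [h₁]
  exact congrArg Subtype.val h₂

theorem Matrix.mul_mul_conjTranspose_mul_self_eq {A : Matrix m n ℍ[ℝ]} {G : Matrix n n ℍ[ℝ]}
    (h : Aᴴ * A * G * (Aᴴ * A) = Aᴴ * A) : A * G * (Aᴴ * A) = A := by
  refine sub_eq_zero.mp (eq_zero_of_conjTranspose_mul_self_eq_zero ?_)
  have h' : Aᴴ * (A * G * (Aᴴ * A) - A) = 0 := by
    simp only [Matrix.mul_assoc] at h
    rw [Matrix.mul_sub, Matrix.mul_assoc, h, sub_self]
  have e : (A * G * (Aᴴ * A) - A)ᴴ = (Aᴴ * A * Gᴴ - 1) * Aᴴ := by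
    simp only [conjTranspose_sub, conjTranspose_mul, conjTranspose_conjTranspose,
      Matrix.sub_mul, Matrix.one_mul, Matrix.mul_assoc]
  rw [e, Matrix.mul_assoc, h', Matrix.mul_zero]

theorem Matrix.exists_least_squares_inverse (A : Matrix m n ℍ[ℝ]) :
    ∃ L : Matrix n m ℍ[ℝ], A * L * A = A ∧ (A * L)ᴴ = A * L := by
  obtain ⟨G, hG⟩ := exists_mul_mul_self_eq (Aᴴ * A)
  have h₁ := mul_mul_conjTranspose_mul_self_eq hG
  refine ⟨G * Aᴴ, by simpa only [Matrix.mul_assoc] using h₁, ?_⟩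
  have e : (A * (G * Aᴴ)) * (A * (G * Aᴴ))ᴴ = (A * (G * Aᴴ))ᴴ := by
    simp only [conjTranspose_mul, conjTranspose_conjTranspose]
    calc _ = A * G * (Aᴴ * A) * (Gᴴ * Aᴴ) := by simp only [Matrix.mul_assoc]
      _ = _ := by rw [h₁]; simp only [Matrix.mul_assoc]
  have e' := congrArg conjTranspose e
  rw [conjTranspose_mul, conjTranspose_conjTranspose, e] at e'
  exact e'

theorem exists_isMP (A : Matrix m n ℍ[ℝ]) : ∃ X, IsMP A X := by
  obtain ⟨L, hL, hL'⟩ := exists_least_squares_inverse A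
  obtain ⟨K, hK, hK'⟩ := exists_least_squares_inverse Aᴴ
  have h₁ : A * Kᴴ * A = A := by
    have := congrArg conjTranspose hK
    simpa only [conjTranspose_mul, conjTranspose_conjTranspose, Matrix.mul_assoc] using this
  have h₂ : (Kᴴ * A)ᴴ = Kᴴ * A := by
    have := congrArg conjTranspose hK'
    simpa only [conjTranspose_mul, conjTranspose_conjTranspose] using this
  have e₁ : A * (Kᴴ * A * L) = A * L := by
    rw [← Matrix.mul_assoc, ← Matrix.mul_assoc, h₁]
  have e₂ : Kᴴ * A * L * A = Kᴴ * A := by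
    rw [Matrix.mul_assoc, Matrix.mul_assoc, ← Matrix.mul_assoc A, hL]
  refine ⟨Kᴴ * A * L, ?_, ?_, by rw [e₁, hL'], by rw [e₂, h₂]⟩
  · rw [e₁, hL]
  · rw [e₂, Matrix.mul_assoc, e₁, ← Matrix.mul_assoc]

theorem isMP_dg (A : Matrix m n ℍ[ℝ]) : IsMP A (dg A) := by
  rw [dg, dif_pos (exists_isMP A)]
  exact (exists_isMP A).choose_spec

theorem mul_dg_mul_self (A : Matrix m n ℍ[ℝ]) : A * dg A * A = A :=
  (isMP_dg A).1

theorem mul_lproj [DecidableEq n] (A : Matrix m n ℍ[ℝ]) : A * lproj A = 0 := by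
  rw [lproj, Matrix.mul_sub, Matrix.mul_one, ← Matrix.mul_assoc, mul_dg_mul_self, sub_self]

theorem rproj_mul [DecidableEq m] (A : Matrix m n ℍ[ℝ]) : rproj A * A = 0 := by
  rw [rproj, Matrix.sub_mul, Matrix.one_mul, mul_dg_mul_self, sub_self]

theorem rproj_mul_eq_zero_iff [DecidableEq m] {l : Type*} (A : Matrix m n ℍ[ℝ])
    (C : Matrix m l ℍ[ℝ]) : rproj A * C = 0 ↔ A * (dg A * C) = C := by
  rw [rproj, Matrix.sub_mul, Matrix.one_mul, sub_eq_zero, Matrix.mul_assoc, eq_comm]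

theorem mul_lproj_eq_zero_iff [DecidableEq n] {l : Type*} (A : Matrix m n ℍ[ℝ])
    (C : Matrix l n ℍ[ℝ]) : C * lproj A = 0 ↔ C * dg A * A = C := by
  rw [lproj, Matrix.mul_sub, Matrix.mul_one, sub_eq_zero, Matrix.mul_assoc, eq_comm]

end GeneralizedInverse

section EtaConjugate

variable {η : ℍ[ℝ]} {l m n : Type*}

theorem IsImUnit.star_eq (hη : IsImUnit η) : star η = -η := by
  rw [Quaternion.star_eq_neg]
  rcases hη with rfl | rfl | rfl <;> rfl

theorem IsImUnit.normSq_eq_one (hη : IsImUnit η) : Quaternion.normSq η = 1 := by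
  rw [Quaternion.normSq_def']
  rcases hη with rfl | rfl | rfl <;> norm_num

theorem IsImUnit.mul_self (hη : IsImUnit η) : η * η = -1 := by
  have h := Quaternion.self_mul_star η
  rw [hη.star_eq, hη.normSq_eq_one, mul_neg, Quaternion.coe_one] at h
  exact neg_eq_iff_eq_neg.mp h

theorem etaC_add (A B : Matrix m n ℍ[ℝ]) : etaC η (A + B) = etaC η A + etaC η B := by
  ext1 i j
  simp only [etaC, of_apply, Matrix.add_apply, star_add, mul_add, add_mul]

theorem etaC_sub (A B : Matrix m n ℍ[ℝ]) : etaC η (A - B) = etaC η A - etaC η B := by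
  ext1 i j
  simp only [etaC, of_apply, Matrix.sub_apply, star_sub, mul_sub, sub_mul]

theorem etaC_zero : etaC η (0 : Matrix m n ℍ[ℝ]) = 0 := by
  ext1 i j
  simp only [etaC, of_apply, Matrix.zero_apply, star_zero, mul_zero, zero_mul]

theorem etaC_smul (r : ℝ) (A : Matrix m n ℍ[ℝ]) : etaC η (r • A) = r • etaC η A := by
  ext1 i j
  simp only [etaC, of_apply, Matrix.smul_apply, Quaternion.star_smul, mul_smul_comm, smul_mul_assoc]

theorem etaC_one [DecidableEq n] (hη : IsImUnit η) :
    etaC η (1 : Matrix n n ℍ[ℝ]) = 1 := by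
  ext1 i j
  by_cases h : i = j
  · subst h
    simp only [etaC, of_apply, one_apply_eq, star_one, mul_one, neg_mul, hη.mul_self, neg_neg]
  · simp only [etaC, of_apply, one_apply_ne h, one_apply_ne (Ne.symm h), star_zero, mul_zero,
      zero_mul]

theorem etaC_etaC (hη : IsImUnit η) (A : Matrix m n ℍ[ℝ]) : etaC η (etaC η A) = A := by
  ext1 i j
  simp only [etaC, of_apply, star_mul, star_neg, star_star, hη.star_eq]
  calc _ = (η * η) * A i j * (η * η) := by noncomm_ring
    _ = _ := by simp only [hη.mul_self, neg_mul, one_mul, mul_neg, mul_one, neg_neg]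

theorem etaC_mul [Fintype m] (hη : IsImUnit η) (A : Matrix l m ℍ[ℝ]) (B : Matrix m n ℍ[ℝ]) :
    etaC η (A * B) = etaC η B * etaC η A := by
  ext1 i j
  simp only [etaC, of_apply, mul_apply, star_sum, star_mul, Finset.mul_sum, Finset.sum_mul]
  refine Finset.sum_congr rfl fun k _ => ?_
  calc _ = -η * star (B k i) * (- -1) * star (A j k) * η := by noncomm_ring
    _ = -η * star (B k i) * (-(η * η)) * star (A j k) * η := by rw [hη.mul_self]
    _ = _ := by noncomm_ring

end EtaConjugate

section Solvability

variable {η : ℍ[ℝ]} {m n p : Type*} [Fintype m] [Fintype n]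

/-- A matrix equation `A X A^{η*} + C Y C^{η*} = D` with η-Hermitian right-hand side that is
solvable is solvable in η-Hermitian unknowns. -/
theorem exists_etaHermitian_of_exists (hη : IsImUnit η)
    {A : Matrix p m ℍ[ℝ]} {C : Matrix p n ℍ[ℝ]} {D : Matrix p p ℍ[ℝ]} (hD : etaC η D = D)
    {X : Matrix m m ℍ[ℝ]} {Y : Matrix n n ℍ[ℝ]}
    (h : A * X * etaC η A + C * Y * etaC η C = D) :
    ∃ (U : Matrix m m ℍ[ℝ]) (V : Matrix n n ℍ[ℝ]), etaC η U = U ∧ etaC η V = V ∧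
      A * U * etaC η A + C * V * etaC η C = D := by
  have h' := congrArg (etaC η) h
  rw [hD, etaC_add, etaC_mul hη, etaC_mul hη, etaC_mul hη (C * Y), etaC_mul hη C,
    etaC_etaC hη, etaC_etaC hη, ← Matrix.mul_assoc, ← Matrix.mul_assoc] at h'
  refine ⟨(1 / 2 : ℝ) • (X + etaC η X), (1 / 2 : ℝ) • (Y + etaC η Y), ?_, ?_, ?_⟩
  · rw [etaC_smul, etaC_add, etaC_etaC hη, add_comm]
  · rw [etaC_smul, etaC_add, etaC_etaC hη, add_comm]
  · have e : A * ((1 / 2 : ℝ) • (X + etaC η X)) * etaC η A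
        + C * ((1 / 2 : ℝ) • (Y + etaC η Y)) * etaC η C
        = (1 / 2 : ℝ) • ((A * X * etaC η A + C * Y * etaC η C)
          + (A * etaC η X * etaC η A + C * etaC η Y * etaC η C)) := by
      simp only [Matrix.mul_smul, Matrix.smul_mul, Matrix.mul_add, Matrix.add_mul, smul_add]
      abel
    rw [e, h, h', ← two_smul ℝ D, smul_smul]
    norm_num

/-- The equation `A X A^{η*} + C Y C^{η*} = D` with η-Hermitian right-hand side is solvable in
η-Hermitian unknowns when `R_M R_A D = 0` and `R_A D (R_C)^{η*} = 0`, where `M = R_A C`. -/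
theorem exists_etaHermitian_solution [Fintype p] [DecidableEq p] [DecidableEq n] (hη : IsImUnit η)
    {A : Matrix p m ℍ[ℝ]} {C : Matrix p n ℍ[ℝ]} {D : Matrix p p ℍ[ℝ]} (hD : etaC η D = D)
    (h₁ : rproj (rproj A * C) * rproj A * D = 0)
    (h₂ : rproj A * D * etaC η (rproj C) = 0) :
    ∃ (U : Matrix m m ℍ[ℝ]) (V : Matrix n n ℍ[ℝ]), etaC η U = U ∧ etaC η V = V ∧
      A * U * etaC η A + C * V * etaC η C = D := by
  set R := rproj A with hR
  set M := R * C with hM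
  set N := dg M
  -- The two conditions in the form `R D = M N R D` and `R D = R D (C C†)^{η*}`.
  rw [Matrix.mul_assoc, rproj_mul_eq_zero_iff] at h₁
  have h₂' : R * D * (etaC η (dg C) * etaC η C) = R * D := by
    rw [rproj, etaC_sub, etaC_one hη, etaC_mul hη, Matrix.mul_sub, Matrix.mul_one,
      sub_eq_zero] at h₂
    exact h₂.symm
  have h₁s : D * etaC η R * etaC η N * etaC η M = D * etaC η R := by
    have := congrArg (etaC η) h₁
    simpa only [etaC_mul hη, hD, Matrix.mul_assoc] using this
  have h₂s : C * dg C * (D * etaC η R) = D * etaC η R := by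
    have := congrArg (etaC η) h₂'
    simpa only [etaC_mul hη, etaC_etaC hη, hD, Matrix.mul_assoc] using this
  have hMs : etaC η M = etaC η C * etaC η R := by rw [hM, etaC_mul hη]
  let Y := N * (R * D) * etaC η (dg C) + lproj M * (dg C * (D * etaC η R) * etaC η N)
  have hY₁ : R * (C * Y * etaC η C) = R * D := by
    calc R * (C * Y * etaC η C)
        = M * (N * (R * D)) * etaC η (dg C) * etaC η C
          + (M * lproj M) * (dg C * (D * etaC η R) * etaC η N) * etaC η C := by
          simp only [Y, hM, Matrix.mul_add, Matrix.add_mul, Matrix.mul_assoc]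
      _ = R * D := by
          rw [mul_lproj, h₁, Matrix.zero_mul, Matrix.zero_mul, add_zero, Matrix.mul_assoc, h₂']
  have hY₂ : C * Y * etaC η C * etaC η R = D * etaC η R := by
    calc C * Y * etaC η C * etaC η R
        = C * N * (R * D * (etaC η (dg C) * etaC η C)) * etaC η R
          + C * lproj M * dg C * (D * etaC η R * etaC η N * etaC η M) := by
          simp only [Y, hMs, Matrix.mul_add, Matrix.add_mul, Matrix.mul_assoc]
      _ = C * N * R * (D * etaC η R) + C * lproj M * dg C * (D * etaC η R) := by
          rw [h₂', h₁s]
          simp only [Matrix.mul_assoc]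
      _ = C * N * R * (C * dg C * (D * etaC η R)) + C * dg C * (D * etaC η R)
          - C * N * R * (C * dg C * (D * etaC η R)) := by
          rw [h₂s, lproj]
          simp only [Matrix.mul_sub, Matrix.sub_mul, Matrix.mul_one]
          rw [← add_sub_assoc, h₂s]
          congr 1
          rw [← congrArg (C * N * R * ·) h₂s]
          simp only [hM, N, Matrix.mul_assoc]
      _ = D * etaC η R := by rw [add_sub_cancel_left, h₂s]
  have hE₁ : A * dg A * (D - C * Y * etaC η C) = D - C * Y * etaC η C := by
    rw [Matrix.mul_assoc, ← rproj_mul_eq_zero_iff, Matrix.mul_sub, hY₁, sub_self]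
  have hE₂ : (D - C * Y * etaC η C) * (etaC η (dg A) * etaC η A) = D - C * Y * etaC η C := by
    have h : (D - C * Y * etaC η C) * etaC η R = 0 := by rw [Matrix.sub_mul, hY₂, sub_self]
    rw [hR, rproj, etaC_sub, etaC_one hη, etaC_mul hη, Matrix.mul_sub, Matrix.mul_one,
      sub_eq_zero] at h
    exact h.symm
  refine exists_etaHermitian_of_exists hη hD
    (X := dg A * (D - C * Y * etaC η C) * etaC η (dg A)) (Y := Y) ?_
  have e : A * (dg A * (D - C * Y * etaC η C) * etaC η (dg A)) * etaC η A
      = A * dg A * (D - C * Y * etaC η C) * (etaC η (dg A) * etaC η A) := by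
    simp only [Matrix.mul_assoc]
  rw [e, hE₁, hE₂, sub_add_cancel]

theorem rproj_conditions_of_solution [Fintype p] [DecidableEq p] (hη : IsImUnit η)
    {A : Matrix p m ℍ[ℝ]} {C : Matrix p n ℍ[ℝ]} {D : Matrix p p ℍ[ℝ]}
    {X : Matrix m m ℍ[ℝ]} {Y : Matrix n n ℍ[ℝ]}
    (h : A * X * etaC η A + C * Y * etaC η C = D) :
    rproj (rproj A * C) * rproj A * D = 0 ∧ rproj A * D * etaC η (rproj C) = 0 := by
  have hD : rproj A * D = rproj A * C * (Y * etaC η C) := by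
    calc rproj A * D = rproj A * A * (X * etaC η A) + rproj A * C * (Y * etaC η C) := by
          rw [← h]
          simp only [Matrix.mul_add, Matrix.mul_assoc]
      _ = _ := by rw [rproj_mul, Matrix.zero_mul, zero_add]
  refine ⟨?_, ?_⟩
  · rw [Matrix.mul_assoc, hD, ← Matrix.mul_assoc, rproj_mul, Matrix.zero_mul]
  · rw [hD, Matrix.mul_assoc, Matrix.mul_assoc Y, ← etaC_mul hη, rproj_mul, etaC_zero,
      Matrix.mul_zero, Matrix.mul_zero]

/-- The canonical solution of `A X = C` in η-Hermitian `X`. -/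
def etaSol (η : ℍ[ℝ]) (A C : Matrix m n ℍ[ℝ]) : Matrix n n ℍ[ℝ] :=
  dg A * C + etaC η (dg A * C) - dg A * A * etaC η C * etaC η (dg A)

theorem etaSol_etaHermitian (hη : IsImUnit η) {A C : Matrix m n ℍ[ℝ]}
    (h : A * etaC η C = C * etaC η A) : etaC η (etaSol η A C) = etaSol η A C := by
  have e : dg A * A * etaC η C * etaC η (dg A) = dg A * C * etaC η A * etaC η (dg A) := by
    rw [Matrix.mul_assoc (dg A), h, ← Matrix.mul_assoc]
  rw [etaSol, etaC_sub, etaC_add, etaC_etaC hη, add_comm]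
  congr 1
  rw [e]
  simp only [etaC_mul hη, etaC_etaC hη]
  simp only [← Matrix.mul_assoc, e]

theorem mul_etaSol [DecidableEq m] (hη : IsImUnit η) {A C : Matrix m n ℍ[ℝ]}
    (h : rproj A * C = 0) : A * etaSol η A C = C := by
  rw [rproj_mul_eq_zero_iff] at h
  rw [etaSol, Matrix.mul_sub, Matrix.mul_add, h, etaC_mul hη]
  simp only [← Matrix.mul_assoc, mul_dg_mul_self, add_sub_cancel_right]

theorem lproj_mul_mul_etaC_lproj [DecidableEq n] (hη : IsImUnit η) {A C : Matrix m n ℍ[ℝ]}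
    {X : Matrix n n ℍ[ℝ]} (hX : etaC η X = X) (h : A * X = C) :
    lproj A * X * etaC η (lproj A) = X - etaSol η A C := by
  have h' : X * etaC η A = etaC η C := by rw [← h, etaC_mul hη, hX]
  simp only [lproj, etaSol, etaC_sub, etaC_one hη, etaC_mul hη, Matrix.sub_mul, Matrix.mul_sub,
    Matrix.one_mul, Matrix.mul_one]
  have e₁ : dg A * A * X = dg A * C := by rw [Matrix.mul_assoc, h]
  have e₂ : X * (etaC η A * etaC η (dg A)) = etaC η C * etaC η (dg A) := by
    rw [← Matrix.mul_assoc, h']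
  have e₃ : dg A * A * X * (etaC η A * etaC η (dg A))
      = dg A * A * etaC η C * etaC η (dg A) := by
    rw [Matrix.mul_assoc _ X, e₂, Matrix.mul_assoc, Matrix.mul_assoc, Matrix.mul_assoc]
  rw [e₃, e₁, e₂]
  abel

/-- The canonical solution of `Y B = D` in η-Hermitian `Y`. -/
def etaSolRight (η : ℍ[ℝ]) (B D : Matrix n m ℍ[ℝ]) : Matrix n n ℍ[ℝ] :=
  D * dg B + etaC η (D * dg B) - etaC η (dg B) * etaC η B * D * dg B

theorem etaSolRight_etaHermitian (hη : IsImUnit η) {B D : Matrix n m ℍ[ℝ]}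
    (h : etaC η B * D = etaC η D * B) : etaC η (etaSolRight η B D) = etaSolRight η B D := by
  rw [etaSolRight, etaC_sub, etaC_add, etaC_etaC hη, add_comm]
  congr 1
  simp only [etaC_mul hη, etaC_etaC hη]
  rw [Matrix.mul_assoc (etaC η (dg B)) (etaC η B), h]
  simp only [Matrix.mul_assoc]

theorem etaSolRight_mul [DecidableEq m] (hη : IsImUnit η) {B D : Matrix n m ℍ[ℝ]}
    (hs : etaC η B * D = etaC η D * B) (h : D * lproj B = 0) : etaSolRight η B D * B = D := by
  rw [mul_lproj_eq_zero_iff] at h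
  have e : etaC η (dg B) * etaC η B * D * dg B * B = etaC η (D * dg B) * B := by
    calc _ = etaC η (dg B) * (etaC η B * (D * dg B * B)) := by simp only [Matrix.mul_assoc]
      _ = _ := by rw [h, hs, etaC_mul hη, Matrix.mul_assoc]
  rw [etaSolRight, Matrix.sub_mul, Matrix.add_mul, h, e, add_sub_cancel_right]

theorem etaC_rproj_mul_mul_rproj [DecidableEq n] (hη : IsImUnit η) {B D : Matrix n m ℍ[ℝ]}
    {Y : Matrix n n ℍ[ℝ]} (hY : etaC η Y = Y) (h : Y * B = D) :
    etaC η (rproj B) * Y * rproj B = Y - etaSolRight η B D := by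
  have h' : etaC η B * Y = etaC η D := by rw [← h, etaC_mul hη, hY]
  simp only [rproj, etaSolRight, etaC_sub, etaC_one hη, etaC_mul hη, Matrix.sub_mul,
    Matrix.mul_sub, Matrix.one_mul, Matrix.mul_one]
  have e₁ : Y * (B * dg B) = D * dg B := by rw [← Matrix.mul_assoc, h]
  have e₂ : etaC η (dg B) * etaC η B * Y = etaC η (dg B) * etaC η D := by
    rw [Matrix.mul_assoc, h']
  have e₃ : etaC η (dg B) * etaC η B * Y * (B * dg B)
      = etaC η (dg B) * etaC η B * D * dg B := by
    rw [Matrix.mul_assoc _ Y, e₁, Matrix.mul_assoc _ D]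
  rw [e₃, e₁, e₂]
  abel

end Solvability

/-- Solvability criterion for the system
`A₁X = C₁, YB₁ = D₁, A₂XA₂^{η*} + A₃YA₃^{η*} = D₃` in η-Hermitian unknowns `X`, `Y`. -/
theorem quat_etaHermitian_mixed_system_solvable_iff
    {p m₁ a b s : ℕ} (η : ℍ[ℝ]) (hη : IsImUnit η)
    (A₁ : Matrix (Fin m₁) (Fin a) ℍ[ℝ]) (C₁ : Matrix (Fin m₁) (Fin a) ℍ[ℝ])
    (A₂ : Matrix (Fin p) (Fin a) ℍ[ℝ]) (A₃ : Matrix (Fin p) (Fin b) ℍ[ℝ])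
    (B₁ : Matrix (Fin b) (Fin s) ℍ[ℝ]) (D₁ : Matrix (Fin b) (Fin s) ℍ[ℝ])
    (D₃ : Matrix (Fin p) (Fin p) ℍ[ℝ]) (hD₃ : D₃ = etaC η D₃) :
    let B₄ := A₂ * lproj A₁
    let C₄ := A₃ * etaC η (rproj B₁)
    let D₄ := D₃
        - A₂ * (dg A₁ * C₁ + etaC η (dg A₁ * C₁)
            - dg A₁ * A₁ * etaC η C₁ * etaC η (dg A₁)) * etaC η A₂
        - A₃ * (D₁ * dg B₁ + etaC η (D₁ * dg B₁)
            - etaC η (dg B₁) * etaC η B₁ * D₁ * dg B₁) * etaC η A₃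
    let M := rproj B₄ * C₄
    let S := C₄ * lproj M
    ((∃ (X : Matrix (Fin a) (Fin a) ℍ[ℝ]) (Y : Matrix (Fin b) (Fin b) ℍ[ℝ]),
        X = etaC η X ∧ Y = etaC η Y ∧
        A₁ * X = C₁ ∧ Y * B₁ = D₁ ∧
        A₂ * X * etaC η A₂ + A₃ * Y * etaC η A₃ = D₃) ↔
      (A₁ * etaC η C₁ = C₁ * etaC η A₁ ∧ etaC η B₁ * D₁ = etaC η D₁ * B₁ ∧
       rproj A₁ * C₁ = 0 ∧ D₁ * lproj B₁ = 0 ∧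
       rproj M * rproj B₄ * D₄ = 0 ∧ rproj B₄ * D₄ * etaC η (rproj C₄) = 0)) := by
  intro B₄ C₄ D₄ M _
  have hD₄ : D₄ = D₃ - A₂ * etaSol η A₁ C₁ * etaC η A₂
      - A₃ * etaSolRight η B₁ D₁ * etaC η A₃ := rfl
  have hB₄ : ∀ U, B₄ * U * etaC η B₄
      = A₂ * (lproj A₁ * U * etaC η (lproj A₁)) * etaC η A₂ := fun U => by
    simp only [B₄, etaC_mul hη, Matrix.mul_assoc]
  have hC₄ : ∀ V, C₄ * V * etaC η C₄
      = A₃ * (etaC η (rproj B₁) * V * rproj B₁) * etaC η A₃ := fun V => by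
    simp only [C₄, etaC_mul hη, etaC_etaC hη, Matrix.mul_assoc]
  constructor
  · rintro ⟨X, Y, hX, hY, rfl, rfl, h⟩
    have hD : B₄ * X * etaC η B₄ + C₄ * Y * etaC η C₄ = D₄ := by
      rw [hB₄, hC₄, lproj_mul_mul_etaC_lproj hη hX.symm rfl,
        etaC_rproj_mul_mul_rproj hη hY.symm rfl, hD₄, ← h]
      simp only [Matrix.mul_sub, Matrix.sub_mul]
      abel
    refine ⟨?_, ?_, ?_, ?_, rproj_conditions_of_solution hη hD⟩
    · rw [etaC_mul hη, ← hX, Matrix.mul_assoc]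
    · rw [etaC_mul hη, ← hY, Matrix.mul_assoc]
    · rw [← Matrix.mul_assoc, rproj_mul, Matrix.zero_mul]
    · rw [Matrix.mul_assoc, mul_lproj, Matrix.mul_zero]
  · rintro ⟨h₁, h₂, h₃, h₄, h₅, h₆⟩
    have hX₀ := etaSol_etaHermitian hη h₁
    have hY₀ := etaSolRight_etaHermitian hη h₂
    have hD : etaC η D₄ = D₄ := by
      simp only [hD₄, etaC_sub, etaC_mul hη, etaC_etaC hη, hX₀, hY₀, ← hD₃, Matrix.mul_assoc]
    obtain ⟨U, V, hU, hV, h⟩ := exists_etaHermitian_solution hη hD h₅ h₆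
    refine ⟨etaSol η A₁ C₁ + lproj A₁ * U * etaC η (lproj A₁),
      etaSolRight η B₁ D₁ + etaC η (rproj B₁) * V * rproj B₁, ?_, ?_, ?_, ?_, ?_⟩
    · simp only [etaC_add, etaC_mul hη, etaC_etaC hη, hX₀, hU, Matrix.mul_assoc]
    · simp only [etaC_add, etaC_mul hη, etaC_etaC hη, hY₀, hV, Matrix.mul_assoc]
    · rw [Matrix.mul_add, mul_etaSol hη h₃, ← Matrix.mul_assoc, ← Matrix.mul_assoc, mul_lproj,
        Matrix.zero_mul, Matrix.zero_mul, add_zero]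
    · rw [Matrix.add_mul, etaSolRight_mul hη h₂ h₄, Matrix.mul_assoc, rproj_mul,
        Matrix.mul_zero, add_zero]
    · rw [hB₄, hC₄, hD₄] at h
      simp only [Matrix.mul_add, Matrix.add_mul]
      rw [add_add_add_comm, h]
      abel
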